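/- arXiv:2207.13806 — 2 statements merged into one kernel-verified Lean document; each statement's English description precedes it below -/
import Mathlib

section
/- Let (X, d_X) and (Y, d_Y) be metric spaces, let x ∈ X, y ∈ Y, R > 0 and ε > 0. Equip Y × ℝ with the ℓ²-product metric. Suppose f is a map from the open ball B_R(x) ⊆ X to the open ball B_R((y,0)) ⊆ Y × ℝ such that |d_X(x₁,x₂) − d(f(x₁), f(x₂))| < ε for all x₁, x₂ ∈ B_R(x), and such that every point of B_R((y,0)) lies within distance ε of the image f(B_R(x)). Then d(f(x), (y,0)) < √ε · √(9ε + 8R). -/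
/-- Proposition A.3 (prop:centers): if `f` is an `ε`-Gromov–Hausdorff approximation from
the ball `B_R(x) ⊆ X` to the ball `B_R((y,0)) ⊆ Y × ℝ` (with the ℓ²-product metric),
then `d(f(x), (y,0)) < √ε · √(9ε + 8R)`. -/
theorem center_close_to_center {X Y : Type*} [MetricSpace X] [MetricSpace Y]
    (x : X) (y : Y) (R ε : ℝ) (hR : 0 < R) (hε : 0 < ε)
    (f : X → WithLp 2 (Y × ℝ))
    (hmaps : ∀ x' ∈ Metric.ball x R,
      f x' ∈ Metric.ball ((WithLp.equiv 2 (Y × ℝ)).symm (y, 0)) R)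
    (hdist : ∀ x₁ ∈ Metric.ball x R, ∀ x₂ ∈ Metric.ball x R,
      |dist x₁ x₂ - dist (f x₁) (f x₂)| < ε)
    (hsurj : ∀ z ∈ Metric.ball ((WithLp.equiv 2 (Y × ℝ)).symm (y, 0)) R,
      ∃ x' ∈ Metric.ball x R, dist z (f x') < ε) :
    dist (f x) ((WithLp.equiv 2 (Y × ℝ)).symm (y, 0)) <
      Real.sqrt ε * Real.sqrt (9 * ε + 8 * R) := by
  have hL2 : ∀ u v : WithLp 2 (Y × ℝ),
      dist u v = Real.sqrt (dist u.fst v.fst ^ 2 + dist u.snd v.snd ^ 2) := by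
    intro u v
    rw [WithLp.prod_dist_eq_add (by norm_num), Real.sqrt_eq_rpow]
    norm_num
  have key : ∀ σ : ℝ, |σ| < R → (f x).snd * σ ≤ 0 →
      dist (f x) ((WithLp.equiv 2 (Y × ℝ)).symm (y, 0)) ^ 2 < (R + 2 * ε) ^ 2 - σ ^ 2 := by
    intro σ hσ hts
    have hd : ∀ r : ℝ, dist (f x) ((WithLp.equiv 2 (Y × ℝ)).symm (y, r)) ^ 2
        = dist (f x).fst y ^ 2 + ((f x).snd - r) ^ 2 := by
      intro r
      rw [hL2, Real.sq_sqrt (by positivity)]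
      simp [Real.dist_eq, sq_abs]
    have hz : (WithLp.equiv 2 (Y × ℝ)).symm (y, σ) ∈
        Metric.ball ((WithLp.equiv 2 (Y × ℝ)).symm (y, 0)) R := by
      rw [Metric.mem_ball, hL2]
      simpa [Real.dist_eq, Real.sqrt_sq_eq_abs] using hσ
    obtain ⟨x', hx', hzx'⟩ := hsurj _ hz
    have h1 := (abs_lt.mp (hdist x (Metric.mem_ball_self hR) x' hx')).1
    have h2 : dist x x' < R := by rw [dist_comm]; exact hx'
    have h3 := dist_triangle_right (f x) ((WithLp.equiv 2 (Y × ℝ)).symm (y, σ)) (f x')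
    have h4 : dist (f x) ((WithLp.equiv 2 (Y × ℝ)).symm (y, σ)) < R + 2 * ε := by linarith
    have h5 := pow_lt_pow_left₀ h4 dist_nonneg two_ne_zero
    rw [hd] at h5
    rw [hd]
    nlinarith
  rw [← Real.sqrt_mul hε.le]
  apply Real.lt_sqrt_of_sq_lt
  obtain hRε | hRε := le_or_gt R ε
  · have := key 0 (by simpa using hR) (by simp)
    nlinarith [mul_pos hR hε]
  · obtain ht | ht := le_total (f x).snd 0
    · have := key (R - ε) (by rw [abs_of_pos] <;> linarith)
        (mul_nonpos_of_nonpos_of_nonneg ht (by linarith))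
      nlinarith [mul_pos hR hε]
    · have := key (-(R - ε)) (by rw [abs_neg, abs_of_pos] <;> linarith)
        (mul_nonpos_of_nonneg_of_nonpos ht (by linarith))
      nlinarith [mul_pos hR hε]
end

section
/- Let (X, d) be a metric space, p, q ∈ X, and A ⊆ X a nonempty set. Suppose (i) every continuous path γ : [0,1] → X with γ(0) = p and γ(1) = q meets A, and (ii) for every ε > 0 there is a continuous path γ : [0,1] → X from p to q whose length (total variation of γ with respect to d) is at most d(p,q) + ε. Then d(p,q) ≥ d(p,A) + d(q,A). -/
/-- The separation estimate from Claim 1 in the proof of Lemma 2.2: if every path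
from `p` to `q` meets the nonempty set `A`, and there are paths from `p` to `q` of
length (total variation) arbitrarily close to `d(p,q)`, then
`d(p,q) ≥ d(p,A) + d(q,A)`. -/
theorem infDist_add_infDist_le_dist_of_separating {X : Type*} [MetricSpace X]
    (p q : X) (A : Set X) (hA : A.Nonempty)
    (hsep : ∀ γ : Path p q, ∃ t : unitInterval, γ t ∈ A)
    (hlen : ∀ ε : ℝ, 0 < ε → ∃ γ : Path p q,
      eVariationOn (γ : unitInterval → X) Set.univ ≤ ENNReal.ofReal (dist p q + ε)) :
    Metric.infDist p A + Metric.infDist q A ≤ dist p q := by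
  refine le_of_forall_pos_le_add fun ε hε => ?_
  obtain ⟨γ, hγ⟩ := hlen ε hε
  obtain ⟨t, ht⟩ := hsep γ
  have h1 : edist p (γ t) ≤ eVariationOn γ (Set.Iic t) := by
    have h := eVariationOn.edist_le γ (s := Set.Iic t) (x := 0) (y := t)
      (Set.mem_Iic.2 unitInterval.nonneg') (Set.mem_Iic.2 le_rfl)
    rwa [γ.source] at h
  have h2 : edist q (γ t) ≤ eVariationOn γ (Set.Ici t) := by
    have h := eVariationOn.edist_le γ (s := Set.Ici t) (x := 1) (y := t)
      (Set.mem_Ici.2 unitInterval.le_one') (Set.mem_Ici.2 le_rfl)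
    rwa [γ.target] at h
  have h3 : eVariationOn γ (Set.Iic t) + eVariationOn γ (Set.Ici t)
      ≤ eVariationOn γ Set.univ :=
    (eVariationOn.add_le_union γ (fun x hx y hy => le_trans hx hy)).trans
      (eVariationOn.mono γ (Set.subset_univ _))
  have h4 := ((add_le_add h1 h2).trans h3).trans hγ
  rw [edist_dist, edist_dist, ← ENNReal.ofReal_add dist_nonneg dist_nonneg,
    ENNReal.ofReal_le_ofReal_iff (by positivity)] at h4
  exact (add_le_add (Metric.infDist_le_dist_of_mem ht)
    (Metric.infDist_le_dist_of_mem ht)).trans h4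
end
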